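/- Under the Hecke-pair setup below, for every u with 0 < u < π/2 one has i · ∫₀^∞ I(t) · sinh((π/2 − u)t) dt = (π/2) e^{iπσ₀/2} e^{−iσ₀u} f(−e^{−iu}/√(4N)) − (π/2) e^{−iπσ₀/2} e^{iσ₀u} f(e^{iu}/√(4N)), the integral converging absolutely. -/

import Mathlib

/-- The sum `f(z) = ∑_{n≥1} a(n) e^{2πinz}` attached to coefficients `a : ℕ → ℝ`. -/
noncomputable def heckeSum (a : ℕ → ℝ) (z : ℂ) : ℂ :=
  ∑' n : ℕ, (a (n + 1) : ℂ) * Complex.exp (2 * Real.pi * Complex.I * ((n : ℂ) + 1) * z)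

open Complex MeasureTheory Set Filter Topology

theorem summable_rpow_mul_exp_neg_nat (β : ℝ) {ε : ℝ} (hε : 0 < ε) :
    Summable fun n : ℕ => ((n : ℝ) + 1) ^ β * Real.exp (-ε * ((n : ℝ) + 1)) := by
  have h := (summable_nat_add_iff 1).mpr (Real.summable_pow_mul_exp_neg_nat_mul ⌈β⌉₊ hε)
  refine Summable.of_nonneg_of_le (fun n => by positivity) (fun n => ?_) h
  push_cast
  gcongr
  rw [← Real.rpow_natCast]
  exact Real.rpow_le_rpow_of_exponent_le (by linarith [n.cast_nonneg (α := ℝ)]) (Nat.le_ceil β)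

theorem norm_heckeSum_term_le {a : ℕ → ℝ} {C β : ℝ} (ha : ∀ n : ℕ, |a n| ≤ C * (n : ℝ) ^ β)
    (n : ℕ) {z : ℂ} {ε : ℝ} (hz : ε ≤ z.im) :
    ‖(a (n + 1) : ℂ) * cexp (2 * Real.pi * I * ((n : ℂ) + 1) * z)‖ ≤
      C * (((n : ℝ) + 1) ^ β * Real.exp (-(2 * Real.pi * ε) * ((n : ℝ) + 1))) := by
  have hre : (2 * Real.pi * I * ((n : ℂ) + 1) * z).re =
      -(2 * Real.pi * z.im) * ((n : ℝ) + 1) := by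
    simp [mul_re, mul_im]
    ring
  rw [norm_mul, norm_exp, hre, norm_real, Real.norm_eq_abs, ← mul_assoc]
  have h := ha (n + 1)
  push_cast at h
  have := Real.pi_pos
  have h0 : 0 ≤ C * ((n : ℝ) + 1) ^ β := (abs_nonneg _).trans h
  gcongr

theorem hasSum_heckeSum {a : ℕ → ℝ} {C β : ℝ} (ha : ∀ n : ℕ, |a n| ≤ C * (n : ℝ) ^ β)
    {z : ℂ} (hz : 0 < z.im) :
    HasSum (fun n : ℕ => (a (n + 1) : ℂ) * cexp (2 * Real.pi * I * ((n : ℂ) + 1) * z))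
      (heckeSum a z) :=
  (Summable.of_norm_bounded
    ((summable_rpow_mul_exp_neg_nat β (by positivity : 0 < 2 * Real.pi * z.im)).mul_left C)
    fun n => norm_heckeSum_term_le ha n le_rfl).hasSum

theorem differentiableAt_heckeSum {a : ℕ → ℝ} {C β : ℝ} (ha : ∀ n : ℕ, |a n| ≤ C * (n : ℝ) ^ β)
    {z : ℂ} (hz : 0 < z.im) : DifferentiableAt ℂ (heckeSum a) z := by
  have hU : IsOpen {w : ℂ | z.im / 2 < w.im} := isOpen_lt continuous_const continuous_im
  have hd : DifferentiableOn ℂ (heckeSum a) {w : ℂ | z.im / 2 < w.im} :=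
    differentiableOn_tsum_of_summable_norm
      ((summable_rpow_mul_exp_neg_nat β
        (by positivity : 0 < 2 * Real.pi * (z.im / 2))).mul_left C)
      (fun n => by fun_prop) hU fun n w hw => norm_heckeSum_term_le ha n (le_of_lt hw)
  exact hd.differentiableAt (hU.mem_nhds (by simp only [mem_ofPred_eq]; linarith))

theorem integrable_exp_neg_mul_abs {δ : ℝ} (hδ : 0 < δ) :
    Integrable fun t : ℝ => Real.exp (-δ * |t|) := by
  refine Integrable.of_integral_ne_zero ?_
  rw [integral_comp_abs (f := fun t => Real.exp (-δ * t)), integral_exp_mul_Ioi (by linarith) 0]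
  simp [hδ.ne']

theorem exists_one_add_rpow_le_exp (B : ℝ) {δ : ℝ} (hδ : 0 < δ) :
    ∃ K : ℝ, 0 ≤ K ∧ ∀ x : ℝ, 0 ≤ x → (1 + x) ^ B ≤ K * Real.exp (δ * x) := by
  set m := ⌈B⌉₊
  refine ⟨δ⁻¹ ^ m * m.factorial * Real.exp δ, by positivity, fun x hx => ?_⟩
  have h1 : (1 + x) ^ B ≤ (1 + x) ^ m := by
    rw [← Real.rpow_natCast]
    exact Real.rpow_le_rpow_of_exponent_le (by linarith) (Nat.le_ceil B)
  have h2 := Real.pow_div_factorial_le_exp (δ * (1 + x)) (by positivity) m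
  rw [div_le_iff₀ (by positivity)] at h2
  calc (1 + x) ^ B ≤ δ⁻¹ ^ m * (δ * (1 + x)) ^ m := by
        rw [← mul_pow, inv_mul_cancel_left₀ hδ.ne']; exact h1
    _ ≤ δ⁻¹ ^ m * (Real.exp (δ * (1 + x)) * m.factorial) := by gcongr
    _ = _ := by rw [mul_add, mul_one, Real.exp_add]; ring

/-- Equality of two vertical integrals of an entire function decaying exponentially in the strip. -/
theorem integral_vertical_eq {g : ℂ → ℂ} (hg : Differentiable ℂ g) {σ₁ σ₂ K δ : ℝ} (hσ : σ₁ ≤ σ₂)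
    (hδ : 0 < δ)
    (hK : ∀ σ t : ℝ, σ₁ ≤ σ → σ ≤ σ₂ → ‖g (σ + t * I)‖ ≤ K * Real.exp (-δ * |t|)) :
    ∫ t : ℝ, g (σ₁ + t * I) = ∫ t : ℝ, g (σ₂ + t * I) := by
  have hint (σ : ℝ) (h1 : σ₁ ≤ σ) (h2 : σ ≤ σ₂) : Integrable fun t : ℝ => g (σ + t * I) :=
    ((integrable_exp_neg_mul_abs hδ).const_mul K).mono'
      (hg.continuous.comp (by fun_prop)).aestronglyMeasurable
      (ae_of_all _ fun t => hK σ t h1 h2)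
  have hlim (σ : ℝ) (h1 : σ₁ ≤ σ) (h2 : σ ≤ σ₂) :
      Tendsto (fun T : ℝ => ∫ t in (-T)..T, g (σ + t * I)) atTop (𝓝 (∫ t : ℝ, g (σ + t * I))) :=
    intervalIntegral_tendsto_integral (hint σ h1 h2) tendsto_neg_atTop_atBot tendsto_id
  have hexp : Tendsto (fun T : ℝ => K * Real.exp (-δ * T) * |σ₂ - σ₁|) atTop (𝓝 0) := by
    have : Tendsto (fun T : ℝ => Real.exp (-δ * T)) atTop (𝓝 0) :=
      Real.tendsto_exp_atBot.comp (tendsto_id.const_mul_atTop_of_neg (by linarith))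
    simpa using (this.const_mul K).mul_const |σ₂ - σ₁|
  have hhor (ε : ℝ) (hε : |ε| = 1) :
      Tendsto (fun T : ℝ => ∫ x in σ₁..σ₂, g (x + ((ε * T : ℝ) : ℂ) * I)) atTop (𝓝 0) := by
    refine squeeze_zero_norm' ?_ hexp
    filter_upwards [eventually_ge_atTop 0] with T hT
    refine intervalIntegral.norm_integral_le_of_norm_le_const fun x hx => ?_
    rw [uIoc_of_le hσ] at hx
    simpa [abs_mul, hε, abs_of_nonneg hT] using hK x (ε * T) hx.1.le hx.2
  have hrect (T : ℝ) : I * ((∫ t in (-T)..T, g (σ₂ + t * I)) - ∫ t in (-T)..T, g (σ₁ + t * I)) =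
      (∫ x in σ₁..σ₂, g (x + ((1 * T : ℝ) : ℂ) * I)) -
        ∫ x in σ₁..σ₂, g (x + ((-1 * T : ℝ) : ℂ) * I) := by
    have h := integral_boundary_rect_eq_zero_of_differentiableOn g (σ₁ + (-T : ℝ) * I)
      (σ₂ + T * I) hg.differentiableOn
    simp at h
    simp
    linear_combination h
  have h1 := ((hlim σ₂ hσ le_rfl).sub (hlim σ₁ le_rfl hσ)).const_mul I
  have h2 := (hhor 1 (by simp)).sub (hhor (-1) (by simp))
  have h3 := tendsto_nhds_unique (h1.congr hrect) h2
  rw [sub_zero, mul_eq_zero, or_iff_right I_ne_zero, sub_eq_zero] at h3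
  exact h3.symm

theorem continuousAt_heckeSum_I_mul {a : ℕ → ℝ} {C β : ℝ}
    (ha : ∀ n : ℕ, |a n| ≤ C * (n : ℝ) ^ β) {l r : ℝ} (hl : 0 < l) (hr : 0 < r) :
    ContinuousAt (fun r : ℝ => heckeSum a (I * l * r)) r := by
  refine ContinuousAt.comp (f := fun r : ℝ => I * l * r)
    (differentiableAt_heckeSum ha ?_).continuousAt (by fun_prop)
  simpa using mul_pos hl hr

theorem heckeSum_term_I_mul (a : ℕ → ℝ) (l r : ℝ) (n : ℕ) :
    (a (n + 1) : ℂ) * cexp (2 * Real.pi * I * ((n : ℂ) + 1) * (I * l * r)) =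
      (a (n + 1) : ℂ) * (Real.exp (-(2 * Real.pi * l * ((n : ℝ) + 1)) * r) : ℝ) := by
  push_cast
  congr 2
  linear_combination 2 * Real.pi * ((n : ℂ) + 1) * l * r * I_sq

theorem summable_coeff_div_rpow {a : ℕ → ℝ} {C β : ℝ}
    (ha : ∀ n : ℕ, |a n| ≤ C * (n : ℝ) ^ β) {κ x : ℝ} (hκ : 0 < κ) (hx : β + 1 < x) :
    Summable fun n : ℕ => ‖(a (n + 1) : ℂ)‖ / (κ * ((n : ℝ) + 1)) ^ x := by
  have h1 : Summable fun n : ℕ => ((n : ℝ) + 1) ^ (β - x) := by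
    have := (summable_nat_add_iff 1).mpr
      (Real.summable_nat_rpow (p := β - x) |>.mpr (by linarith))
    simpa using this
  refine Summable.of_nonneg_of_le (fun n => by positivity) (fun n => ?_) (h1.mul_left (C / κ ^ x))
  have hn : (0 : ℝ) < n + 1 := by positivity
  have h := ha (n + 1)
  push_cast at h
  rw [norm_real, Real.norm_eq_abs, Real.mul_rpow hκ.le hn.le, Real.rpow_sub hn,
    div_mul_div_comm]
  gcongr

theorem mellin_heckeSum {a : ℕ → ℝ} {C β : ℝ} (hβ : 0 < β)
    (ha : ∀ n : ℕ, |a n| ≤ C * (n : ℝ) ^ β) {l : ℝ} (hl : 0 < l) {s : ℂ} (hs : β + 1 < s.re) :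
    mellin (fun r : ℝ => heckeSum a (I * l * r)) s =
      ((2 * Real.pi * l : ℝ) : ℂ) ^ (-s) * Gamma s *
        ∑' n : ℕ, (a (n + 1) : ℂ) * ((n : ℂ) + 1) ^ (-s) := by
  have hκ : 0 < 2 * Real.pi * l := by positivity
  have h := hasSum_mellin (a := fun n : ℕ => (a (n + 1) : ℂ))
    (p := fun n : ℕ => 2 * Real.pi * l * ((n : ℝ) + 1))
    (F := fun r : ℝ => heckeSum a (I * l * r)) (s := s)
    (fun n => Or.inr (by positivity)) (by linarith)
    (fun t ht => by
      have := hasSum_heckeSum ha (z := I * l * t) (by simpa using mul_pos hl ht)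
      simpa only [heckeSum_term_I_mul] using this)
    (summable_coeff_div_rpow ha hκ hs)
  rw [← h.tsum_eq, ← tsum_mul_left]
  refine tsum_congr fun n => ?_
  rw [ofReal_mul (2 * Real.pi * l), mul_cpow_ofReal_nonneg hκ.le (by positivity), cpow_neg,
    cpow_neg]
  push_cast
  field_simp

theorem mellinConvergent_heckeSum {a : ℕ → ℝ} {C β : ℝ} (hβ : 0 < β) (hC : 0 < C)
    (ha : ∀ n : ℕ, |a n| ≤ C * (n : ℝ) ^ β) {l : ℝ} (hl : 0 < l) {x : ℝ} (hx : β + 1 < x) :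
    MellinConvergent (fun r : ℝ => heckeSum a (I * l * r)) x := by
  have hκ : 0 < 2 * Real.pi * l := by positivity
  set b : ℕ → ℝ := fun n => C * (n : ℝ) ^ β with hb_def
  have hbpos : ∀ n : ℕ, 0 < b (n + 1) := fun n => by simp only [hb_def]; positivity
  have hb : ∀ n : ℕ, |b n| ≤ C * (n : ℝ) ^ β := fun n =>
    (abs_of_nonneg (by simp only [hb_def]; positivity)).le
  have hconv : MellinConvergent (fun r : ℝ => heckeSum b (I * l * r)) x := by
    refine Integrable.of_integral_ne_zero ?_
    change mellin _ _ ≠ 0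
    rw [mellin_heckeSum hβ hb hl (by simpa using hx)]
    refine mul_ne_zero (mul_ne_zero ?_ (Gamma_ne_zero_of_re_pos (by simp; linarith))) ?_
    · exact cpow_ne_zero_iff_of_exponent_ne_zero (by simp; linarith) |>.mpr
        (ofReal_ne_zero.mpr hκ.ne')
    · have hterm (n : ℕ) : (b (n + 1) : ℂ) * ((n : ℂ) + 1) ^ (-(x : ℂ)) =
          ((b (n + 1) * ((n : ℝ) + 1) ^ (-x) : ℝ) : ℂ) := by
        push_cast
        rw [ofReal_cpow (by positivity)]
        simp
      simp_rw [hterm]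
      rw [← ofReal_tsum, ofReal_ne_zero]
      refine (Summable.tsum_pos ?_ (fun n => ?_) 0 ?_).ne'
      · have := summable_coeff_div_rpow hb one_pos hx
        refine this.congr fun n => ?_
        rw [norm_real, Real.norm_of_nonneg (hbpos n).le, one_mul, Real.rpow_neg (by positivity),
          div_eq_mul_inv]
      · exact mul_nonneg (hbpos n).le (by positivity)
      · exact mul_pos (hbpos 0) (by positivity)
  refine Integrable.mono hconv ?_ ?_
  · refine ContinuousOn.aestronglyMeasurable (fun t ht => ?_) measurableSet_Ioi
    refine ContinuousAt.continuousWithinAt (ContinuousAt.fun_smul ?_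
      (continuousAt_heckeSum_I_mul ha hl ht))
    exact (continuousAt_ofReal_cpow_const _ _ (Or.inr (ne_of_gt ht)))
  · refine (ae_restrict_iff' measurableSet_Ioi).mpr (ae_of_all _ fun t (ht : 0 < t) => ?_)
    rw [norm_smul, norm_smul]
    beta_reduce
    refine mul_le_mul_of_nonneg_left ?_ (norm_nonneg _)
    have him : 0 < (I * l * t : ℂ).im := by simpa using mul_pos hl ht
    have h1 := hasSum_heckeSum ha him
    have h2 := hasSum_heckeSum hb him
    simp only [heckeSum_term_I_mul, ← ofReal_mul] at h1 h2
    rw [← h1.tsum_eq, ← h2.tsum_eq, ← ofReal_tsum, ← ofReal_tsum, norm_real, norm_real,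
      Real.norm_eq_abs, Real.norm_eq_abs]
    have s1 := (summable_ofReal.mp h1.summable)
    have s2 := (summable_ofReal.mp h2.summable)
    refine le_trans ?_ (le_abs_self _)
    rw [← Real.norm_eq_abs]
    refine tsum_of_norm_bounded s2.hasSum fun n => ?_
    rw [norm_mul, Real.norm_eq_abs, Real.norm_eq_abs, Real.abs_exp]
    exact mul_le_mul_of_nonneg_right (ha _) (Real.exp_nonneg _)

theorem norm_cexp_neg_mul_ofReal_mul_I (w : ℂ) (t : ℝ) :
    ‖cexp (-w * (t * I))‖ = Real.exp (w.im * t) := by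
  rw [norm_exp]
  simp [mul_comm]

theorem norm_mul_cexp_le {z : ℂ} {K δ b t : ℝ} {w : ℂ}
    (hz : ‖z‖ ≤ K * Real.exp (-(Real.pi / 2 - δ) * |t|)) (hw : |w.im| ≤ b) :
    ‖z * cexp (-w * (t * I))‖ ≤ K * Real.exp (-(Real.pi / 2 - b - δ) * |t|) := by
  have h1 : w.im * t ≤ b * |t| :=
    (le_abs_self _).trans (by rw [abs_mul]; gcongr)
  rw [norm_mul, norm_cexp_neg_mul_ofReal_mul_I]
  calc ‖z‖ * Real.exp (w.im * t)
      ≤ K * Real.exp (-(Real.pi / 2 - δ) * |t|) * Real.exp (b * |t|) := by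
        gcongr
        exact (norm_nonneg _).trans hz
    _ = _ := by rw [mul_assoc, ← Real.exp_add]; ring_nf

theorem integrable_mul_cexp {H : ℝ → ℂ} (hH : Continuous H)
    (hdec : ∀ δ : ℝ, 0 < δ → ∃ K : ℝ, ∀ t : ℝ, ‖H t‖ ≤ K * Real.exp (-(Real.pi / 2 - δ) * |t|))
    {w : ℂ} (hw : |w.im| < Real.pi / 2) :
    Integrable fun t : ℝ => H t * cexp (-w * (t * I)) := by
  obtain ⟨K, hK⟩ := hdec ((Real.pi / 2 - |w.im|) / 2) (by linarith)
  refine ((integrable_exp_neg_mul_abs (δ := (Real.pi / 2 - |w.im|) / 2)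
    (by linarith)).const_mul K).mono' (by fun_prop) (ae_of_all _ fun t => ?_)
  convert! norm_mul_cexp_le (hK t) le_rfl using 4
  ring

theorem differentiableAt_integral_mul_cexp {H : ℝ → ℂ} (hH : Continuous H)
    (hdec : ∀ δ : ℝ, 0 < δ → ∃ K : ℝ, ∀ t : ℝ, ‖H t‖ ≤ K * Real.exp (-(Real.pi / 2 - δ) * |t|))
    {w₀ : ℂ} (hw : |w₀.im| < Real.pi / 2) :
    DifferentiableAt ℂ (fun w : ℂ => ∫ t : ℝ, H t * cexp (-w * (t * I))) w₀ := by
  obtain ⟨b, hb0, hb1⟩ := exists_between hw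
  set δ := (Real.pi / 2 - b) / 3 with hδ_def
  have hδ : 0 < δ := by simp only [hδ_def]; linarith
  obtain ⟨K, hK⟩ := hdec δ hδ
  have hs : {w : ℂ | |w.im| < b} ∈ 𝓝 w₀ :=
    (isOpen_lt (continuous_abs.comp continuous_im) continuous_const).mem_nhds hb0
  refine (hasDerivAt_integral_of_dominated_loc_of_deriv_le
    (F' := fun w t => H t * cexp (-w * (t * I)) * (-(t * I)))
    (bound := fun t => K * δ⁻¹ * Real.exp (-δ * |t|)) hs
    (Eventually.of_forall fun w => by fun_prop)
    (integrable_mul_cexp hH hdec hw) (by fun_prop) (ae_of_all _ fun t w hwb => ?_)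
    ((integrable_exp_neg_mul_abs hδ).const_mul _) (ae_of_all _ fun t w _ => ?_)).2.differentiableAt
  · have h1 := norm_mul_cexp_le (hK t) (le_of_lt hwb)
    have h2 : |t| ≤ δ⁻¹ * Real.exp (δ * |t|) := by
      rw [inv_mul_eq_div, le_div_iff₀ hδ]
      linarith [Real.add_one_le_exp (δ * |t|)]
    have h3 : Real.pi / 2 - b - δ = 2 * δ := by simp only [hδ_def]; ring
    rw [h3] at h1
    rw [norm_mul, norm_neg, norm_mul (t : ℂ) I, norm_I, mul_one, norm_real, Real.norm_eq_abs]
    calc _ ≤ K * Real.exp (-(2 * δ) * |t|) * (δ⁻¹ * Real.exp (δ * |t|)) :=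
          mul_le_mul h1 h2 (abs_nonneg _) ((norm_nonneg _).trans h1)
      _ = K * δ⁻¹ * (Real.exp (-(2 * δ) * |t|) * Real.exp (δ * |t|)) := by ring
      _ = _ := by rw [← Real.exp_add]; ring_nf
  · have h : HasDerivAt (fun w : ℂ => -w * (t * I)) (-(t * I)) w := by
      simpa using (hasDerivAt_id w).neg.mul_const ((t : ℂ) * I)
    simpa [mul_assoc] using h.cexp.const_mul (H t)

theorem integral_vertical_mul_cexp_eq_heckeSum {a : ℕ → ℝ} {C β : ℝ} (hβ : 0 < β) (hC : 0 < C)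
    (ha : ∀ n : ℕ, |a n| ≤ C * (n : ℝ) ^ β) {l : ℝ} (hl : 0 < l) {Λ : ℂ → ℂ}
    (hΛcont : Continuous Λ)
    (hΛ : ∀ s : ℂ, β + 1 < s.re →
      Λ s = ((2 * Real.pi * l : ℝ) : ℂ) ^ (-s) * Gamma s *
        ∑' n : ℕ, (a (n + 1) : ℂ) * ((n : ℂ) + 1) ^ (-s))
    {c : ℝ} (hc : β + 1 < c)
    (hdec : ∀ δ : ℝ, 0 < δ → ∃ K : ℝ, ∀ t : ℝ,
      ‖Λ (c + t * I)‖ ≤ K * Real.exp (-(Real.pi / 2 - δ) * |t|))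
    {w : ℂ} (hw : |w.im| < Real.pi / 2) :
    ∫ t : ℝ, Λ (c + t * I) * cexp (-w * (c + t * I)) =
      2 * Real.pi * heckeSum a (I * l * cexp w) := by
  have hH : Continuous fun t : ℝ => Λ (c + t * I) := by fun_prop
  have hsplit (w : ℂ) : ∫ t : ℝ, Λ (c + t * I) * cexp (-w * (c + t * I)) =
      cexp (-w * c) * ∫ t : ℝ, Λ (c + t * I) * cexp (-w * (t * I)) := by
    rw [← integral_const_mul]
    refine integral_congr_ae (ae_of_all _ fun t => ?_)
    simp only [mul_add, Complex.exp_add]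
    ring
  have hmellin (t : ℝ) :
      mellin (fun r : ℝ => heckeSum a (I * l * r)) (c + t * I) = Λ (c + t * I) := by
    rw [mellin_heckeSum hβ ha hl (by simpa using hc), hΛ _ (by simpa using hc)]
  have hvert : VerticalIntegrable (mellin fun r : ℝ => heckeSum a (I * l * r)) c := by
    simp only [VerticalIntegrable, hmellin]
    simpa using integrable_mul_cexp hH hdec (w := 0) (by simp [Real.pi_pos])
  have hreal (x : ℝ) : ∫ t : ℝ, Λ (c + t * I) * cexp (-x * (c + t * I)) =
      2 * Real.pi * heckeSum a (I * l * cexp x) := by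
    have h := mellinInv_mellin_eq c (fun r : ℝ => heckeSum a (I * l * r)) (Real.exp_pos x)
      (mellinConvergent_heckeSum hβ hC ha hl hc) hvert
      (continuousAt_heckeSum_I_mul ha hl (Real.exp_pos x))
    simp only [mellinInv, hmellin, smul_eq_mul, ofReal_exp] at h
    rw [← h, real_smul, ← mul_assoc]
    have hpi : (2 * Real.pi : ℂ) * ((1 / (2 * Real.pi) : ℝ) : ℂ) = 1 := by
      push_cast
      field_simp [Real.pi_ne_zero]
    rw [hpi, one_mul]
    refine integral_congr_ae (ae_of_all _ fun t => ?_)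
    simp only
    rw [cpow_def_of_ne_zero (Complex.exp_ne_zero _), ← ofReal_exp, ← ofReal_log (Real.exp_pos x).le,
      Real.log_exp, mul_comm, neg_mul, mul_neg]
  set U : Set ℂ := {w : ℂ | |w.im| < Real.pi / 2} with hU_def
  have hU : IsOpen U := isOpen_lt (continuous_abs.comp continuous_im) continuous_const
  have hUconn : IsPreconnected U := by
    have : U = imLm ⁻¹' Ioo (-(Real.pi / 2)) (Real.pi / 2) := by
      ext w
      simp [hU_def, abs_lt]
    rw [this]
    exact ((convex_Ioo _ _).linear_preimage imLm).isPreconnected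
  have hf : AnalyticOnNhd ℂ (fun w : ℂ => ∫ t : ℝ, Λ (c + t * I) * cexp (-w * (c + t * I))) U := by
    refine DifferentiableOn.analyticOnNhd (fun z hz => ?_) hU
    simp only [hsplit]
    exact (DifferentiableAt.fun_mul (by fun_prop)
      (differentiableAt_integral_mul_cexp hH hdec hz)).differentiableWithinAt
  have hg : AnalyticOnNhd ℂ (fun w : ℂ => 2 * Real.pi * heckeSum a (I * l * cexp w)) U := by
    refine DifferentiableOn.analyticOnNhd (fun z hz => ?_) hU
    have him : 0 < (I * l * cexp z).im := by
      have : 0 < l * (Real.exp z.re * Real.cos z.im) :=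
        mul_pos hl (mul_pos (Real.exp_pos _) (Real.cos_pos_of_mem_Ioo (abs_lt.mp hz)))
      simpa [mul_im, mul_re, exp_re] using this
    exact (((differentiableAt_heckeSum ha him).comp z
      (f := fun w => I * l * cexp w) (by fun_prop)).const_mul _).differentiableWithinAt
  refine hf.eqOn_of_preconnected_of_frequently_eq hg hUconn (z₀ := 0)
    (by simp [hU_def, Real.pi_pos]) ?_ hw
  have htend : Tendsto (fun x : ℝ => (x : ℂ)) (𝓝[≠] 0) (𝓝[≠] 0) := by
    refine tendsto_nhdsWithin_iff.mpr ⟨?_, ?_⟩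
    · exact (continuous_ofReal.tendsto' 0 0 ofReal_zero).mono_left nhdsWithin_le_nhds
    · filter_upwards [self_mem_nhdsWithin] with x hx
      simpa using hx
  exact htend.frequently (Eventually.of_forall hreal).frequently

theorem exists_exp_decay_of_rpow_mul_exp {Λ Λ' : ℂ → ℂ} {σ₁ σ₂ : ℝ}
    (h : ∃ C' B : ℝ, ∀ σ t : ℝ, σ₁ ≤ σ → σ ≤ σ₂ →
      ‖Λ ((σ : ℂ) + (t : ℂ) * I)‖ + ‖Λ' ((σ : ℂ) + (t : ℂ) * I)‖ ≤
        C' * (1 + |t|) ^ B * Real.exp (-Real.pi * |t| / 2)) {δ : ℝ} (hδ : 0 < δ) :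
    ∃ K : ℝ, ∀ σ t : ℝ, σ₁ ≤ σ → σ ≤ σ₂ →
      ‖Λ (σ + t * I)‖ ≤ K * Real.exp (-(Real.pi / 2 - δ) * |t|) := by
  obtain ⟨C', B, h⟩ := h
  obtain ⟨K, -, hK⟩ := exists_one_add_rpow_le_exp B hδ
  refine ⟨|C'| * K, fun σ t h1 h2 => ?_⟩
  calc ‖Λ (σ + t * I)‖ ≤ C' * (1 + |t|) ^ B * Real.exp (-Real.pi * |t| / 2) :=
        (le_add_of_nonneg_right (norm_nonneg _)).trans (h σ t h1 h2)
    _ ≤ |C'| * (K * Real.exp (δ * |t|)) * Real.exp (-Real.pi * |t| / 2) := by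
        gcongr
        · exact le_abs_self _
        · exact hK _ (abs_nonneg t)
    _ = |C'| * K * (Real.exp (δ * |t|) * Real.exp (-Real.pi * |t| / 2)) := by ring
    _ = _ := by rw [← Real.exp_add]; ring_nf

theorem integral_critical_line_mul_exp {a : ℕ → ℝ} {C β : ℝ} (hβ : 0 < β) (hC : 0 < C)
    (ha : ∀ n : ℕ, |a n| ≤ C * (n : ℝ) ^ β) {l : ℝ} (hl : 0 < l) {Λ : ℂ → ℂ}
    (hΛdiff : Differentiable ℂ Λ)
    (hΛ : ∀ s : ℂ, β + 1 < s.re →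
      Λ s = ((2 * Real.pi * l : ℝ) : ℂ) ^ (-s) * Gamma s *
        ∑' n : ℕ, (a (n + 1) : ℂ) * ((n : ℂ) + 1) ^ (-s))
    (hdec : ∀ σ₁ σ₂ δ : ℝ, 0 < δ → ∃ K : ℝ, ∀ σ t : ℝ, σ₁ ≤ σ → σ ≤ σ₂ →
      ‖Λ (σ + t * I)‖ ≤ K * Real.exp (-(Real.pi / 2 - δ) * |t|))
    (σ : ℝ) {θ : ℝ} (hθ : |θ| < Real.pi / 2) :
    ∫ t : ℝ, Λ (σ + t * I) * Real.exp (θ * t) =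
      2 * Real.pi * cexp (I * θ * σ) * heckeSum a (I * l * cexp (I * θ)) := by
  have him : (I * θ : ℂ).im = θ := by simp
  set c := max σ (β + 2)
  obtain ⟨K, hK⟩ := hdec σ c ((Real.pi / 2 - |θ|) / 2) (by linarith)
  have hnorm (x : ℝ) : ‖cexp (-(I * θ) * x)‖ = 1 := by
    rw [norm_exp]
    simp
  have hshift := integral_vertical_eq (g := fun s => Λ s * cexp (-(I * θ) * s))
    (hΛdiff.mul (by fun_prop)) (le_max_left σ (β + 2))
    (δ := (Real.pi / 2 - |θ|) / 2) (K := K) (by linarith) fun x t h1 h2 => by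
      have h := norm_mul_cexp_le (w := I * θ) (b := |θ|) (hK x t h1 h2) (by rw [him])
      rw [mul_add, Complex.exp_add, mul_left_comm, norm_mul, hnorm, one_mul]
      convert! h using 4
      ring
  have hcont := integral_vertical_mul_cexp_eq_heckeSum hβ hC ha hl hΛdiff.continuous hΛ (c := c)
    (lt_of_lt_of_le (by linarith) (le_max_right σ (β + 2)))
    (fun δ hδ => (hdec c c δ hδ).imp fun K hK t => hK c t le_rfl le_rfl)
    (w := I * θ) (by rwa [him])
  rw [← hshift] at hcont
  rw [mul_right_comm, ← hcont, mul_comm, ← integral_const_mul]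
  refine integral_congr_ae (ae_of_all _ fun t => ?_)
  simp only
  rw [mul_left_comm, ← Complex.exp_add, ofReal_exp]
  congr 2
  push_cast
  linear_combination (θ * t : ℂ) * I_sq

theorem integral_mul_sinh_eq {g : ℝ → ℂ} {v : ℝ}
    (h1 : Integrable fun t : ℝ => g t * Real.exp (v * t))
    (h2 : Integrable fun t : ℝ => g t * Real.exp (-v * t)) :
    IntegrableOn (fun t : ℝ => (g t - g (-t)) * (Real.sinh (v * t) : ℂ)) (Ioi 0) ∧
    2 * ∫ t in Ioi (0 : ℝ), (g t - g (-t)) * (Real.sinh (v * t) : ℂ) =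
      (∫ t : ℝ, g t * Real.exp (v * t)) - ∫ t : ℝ, g t * Real.exp (-v * t) := by
  set h : ℝ → ℂ := fun t => g t * Real.exp (v * t) - g t * Real.exp (-v * t) with h_def
  have hh : Integrable h := h1.sub h2
  have hfun : (fun t : ℝ => (g t - g (-t)) * (Real.sinh (v * t) : ℂ)) =
      fun t => (1 / 2 : ℂ) * (h t + h (-t)) := by
    funext t
    simp only [h_def, Real.sinh_eq]
    push_cast
    ring_nf
  rw [hfun]
  refine ⟨((hh.add hh.comp_neg).const_mul _).integrableOn, ?_⟩
  rw [integral_const_mul, integral_add hh.integrableOn hh.comp_neg.integrableOn,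
    integral_comp_neg_Ioi, neg_zero, ← integral_sub h1 h2,
    ← intervalIntegral.integral_Iic_add_Ioi (b := (0 : ℝ)) hh.integrableOn hh.integrableOn]
  ring

/-- In the Hecke-pair setup, for `0 < u < π/2`,
`i ∫₀^∞ I(t) sinh((π/2−u)t) dt
  = (π/2) e^{iπσ₀/2} e^{−iσ₀u} f(−e^{−iu}/√(4N)) − (π/2) e^{−iπσ₀/2} e^{iσ₀u} f(e^{iu}/√(4N))`,
the integral converging absolutely. -/
theorem stmt_6 (k N : ℕ) (hk : 0 < k) (hN : 0 < N)
    (σ₀ : ℝ) (hσ₀ : σ₀ = (k : ℝ) / 2 + 1 / 4)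
    (a a' : ℕ → ℝ) (C β : ℝ) (hC : 0 < C) (hβ : 0 < β)
    (ha : ∀ n : ℕ, |a n| ≤ C * (n : ℝ) ^ β)
    (ha' : ∀ n : ℕ, |a' n| ≤ C * (n : ℝ) ^ β)
    (Λ Λ' : ℂ → ℂ)
    (hΛdiff : Differentiable ℂ Λ) (hΛ'diff : Differentiable ℂ Λ')
    (hΛ : ∀ s : ℂ, β + 1 < s.re →
      Λ s = ((2 * Real.pi / Real.sqrt (4 * (N : ℝ)) : ℝ) : ℂ) ^ (-s) * Complex.Gamma s *
        ∑' n : ℕ, (a (n + 1) : ℂ) * ((n : ℂ) + 1) ^ (-s))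
    (hΛ' : ∀ s : ℂ, β + 1 < s.re →
      Λ' s = ((2 * Real.pi / Real.sqrt (4 * (N : ℝ)) : ℝ) : ℂ) ^ (-s) * Complex.Gamma s *
        ∑' n : ℕ, (a' (n + 1) : ℂ) * ((n : ℂ) + 1) ^ (-s))
    (hFE : ∀ s : ℂ, Λ s = Λ' ((k : ℂ) + 1 / 2 - s))
    (hstrip : ∀ σ₁ σ₂ : ℝ, ∃ C' B : ℝ, ∀ σ t : ℝ, σ₁ ≤ σ → σ ≤ σ₂ →
      ‖Λ ((σ : ℂ) + (t : ℂ) * Complex.I)‖ +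
        ‖Λ' ((σ : ℂ) + (t : ℂ) * Complex.I)‖ ≤
          C' * (1 + |t|) ^ B * Real.exp (-Real.pi * |t| / 2))
    (I : ℝ → ℂ)
    (hI : ∀ t : ℝ, I t =
      (Λ ((σ₀ : ℂ) + (t : ℂ) * Complex.I) - Λ' ((σ₀ : ℂ) + (t : ℂ) * Complex.I)) /
        (2 * Complex.I))
    (u : ℝ) (hu1 : 0 < u) (hu2 : u < Real.pi / 2) :
    MeasureTheory.IntegrableOn
      (fun t : ℝ => I t * (Real.sinh ((Real.pi / 2 - u) * t) : ℂ)) (Set.Ioi 0) ∧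
    Complex.I * ∫ t in Set.Ioi (0 : ℝ), I t * (Real.sinh ((Real.pi / 2 - u) * t) : ℂ) =
      (Real.pi / 2 : ℂ) * Complex.exp (Complex.I * Real.pi * σ₀ / 2) *
          Complex.exp (-Complex.I * σ₀ * u) *
          heckeSum a (-Complex.exp (-Complex.I * u) / (Real.sqrt (4 * (N : ℝ)) : ℂ)) -
      (Real.pi / 2 : ℂ) * Complex.exp (-Complex.I * Real.pi * σ₀ / 2) *
          Complex.exp (Complex.I * σ₀ * u) *
          heckeSum a (Complex.exp (Complex.I * u) / (Real.sqrt (4 * (N : ℝ)) : ℂ)) := by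
  have hpi := Real.pi_pos
  set v : ℝ := Real.pi / 2 - u with hv_def
  set l : ℝ := (Real.sqrt (4 * (N : ℝ)))⁻¹ with hl_def
  have hl : 0 < l := by
    have : (0 : ℝ) < N := by exact_mod_cast hN
    positivity
  have hv : |v| < Real.pi / 2 := by
    rw [abs_lt]
    constructor <;> simp only [hv_def] <;> linarith
  have hv' : |-v| < Real.pi / 2 := by rwa [abs_neg]
  have hdec (σ₁ σ₂ δ : ℝ) (hδ : 0 < δ) := exists_exp_decay_of_rpow_mul_exp (hstrip σ₁ σ₂) hδ
  have hcrit (θ : ℝ) (hθ : |θ| < Real.pi / 2) :=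
    integral_critical_line_mul_exp hβ hC ha hl hΛdiff
      (by simpa only [hl_def, div_eq_mul_inv] using hΛ) hdec σ₀ hθ
  have hint (θ : ℝ) (hθ : |θ| < Real.pi / 2) :
      Integrable fun t : ℝ => Λ (σ₀ + t * Complex.I) * Real.exp (θ * t) := by
    have h := integrable_mul_cexp (H := fun t : ℝ => Λ (σ₀ + t * Complex.I))
      (hΛdiff.continuous.comp (by fun_prop))
      (fun δ hδ => (hdec σ₀ σ₀ δ hδ).imp fun K hK t => hK σ₀ t le_rfl le_rfl)
      (w := Complex.I * θ) (by simpa using hθ)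
    refine h.congr (ae_of_all _ fun t => ?_)
    simp only [Complex.ofReal_exp]
    congr 2
    push_cast
    linear_combination -(θ * t : ℂ) * Complex.I_sq
  obtain ⟨hI1, hI2⟩ := integral_mul_sinh_eq (hint v hv) (hint (-v) hv')
  have hIeq (t : ℝ) : I t * (Real.sinh (v * t) : ℂ) =
      (1 / (2 * Complex.I)) * ((Λ (σ₀ + t * Complex.I) - Λ (σ₀ + (-t : ℝ) * Complex.I)) *
        (Real.sinh (v * t) : ℂ)) := by
    have hs : (k : ℂ) + 1 / 2 - (σ₀ + (-t : ℝ) * Complex.I) = σ₀ + t * Complex.I := by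
      rw [hσ₀]
      push_cast
      ring
    rw [hI, hFE (σ₀ + (-t : ℝ) * Complex.I), hs]
    ring
  simp only [hIeq]
  refine ⟨hI1.const_mul _, ?_⟩
  rw [integral_const_mul]
  have hz1 : -Complex.exp (-Complex.I * u) / (Real.sqrt (4 * (N : ℝ)) : ℂ) =
      Complex.I * l * Complex.exp (Complex.I * v) := by
    have h : Complex.I * v = Real.pi / 2 * Complex.I + -Complex.I * u := by
      rw [hv_def]
      push_cast
      ring
    rw [h, Complex.exp_add, Complex.exp_pi_div_two_mul_I, hl_def, Complex.ofReal_inv, div_eq_mul_inv]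
    linear_combination
      -((Real.sqrt (4 * (N : ℝ)) : ℂ)⁻¹ * Complex.exp (-Complex.I * u)) * Complex.I_sq
  have hz2 : Complex.exp (Complex.I * u) / (Real.sqrt (4 * (N : ℝ)) : ℂ) =
      Complex.I * l * Complex.exp (Complex.I * (-v : ℝ)) := by
    have h : Complex.I * (-v : ℝ) = -Real.pi / 2 * Complex.I + Complex.I * u := by
      rw [hv_def]
      push_cast
      ring
    rw [h, Complex.exp_add, Complex.exp_neg_pi_div_two_mul_I, hl_def, Complex.ofReal_inv,
      div_eq_mul_inv]
    linear_combination
      ((Real.sqrt (4 * (N : ℝ)) : ℂ)⁻¹ * Complex.exp (Complex.I * u)) * Complex.I_sq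
  have he1 : Complex.exp (Complex.I * v * σ₀) =
      Complex.exp (Complex.I * Real.pi * σ₀ / 2) * Complex.exp (-Complex.I * σ₀ * u) := by
    rw [← Complex.exp_add, hv_def]
    congr 1
    push_cast
    ring
  have he2 : Complex.exp (Complex.I * (-v : ℝ) * σ₀) =
      Complex.exp (-Complex.I * Real.pi * σ₀ / 2) * Complex.exp (Complex.I * σ₀ * u) := by
    rw [← Complex.exp_add, hv_def]
    congr 1
    push_cast
    ring
  rw [hcrit v hv, hcrit (-v) hv', ← hz1, ← hz2, he1, he2] at hI2
  have hII : Complex.I * (1 / (2 * Complex.I)) = 1 / 2 := by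
    field_simp
  rw [← mul_assoc, hII]
  linear_combination (1 / 4 : ℂ) * hI2
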